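/- Let p be non-negative, compactly supported, bounded, and continuous almost everywhere on ℝ^d, and for ε > 0 suppose q ∈ cone(ℱ^d) (a finite non-negative combination of products of smooth Lipschitz pdfs) satisfies q ≤ p and ∫ (p − q) dλ ≤ ε. Then p − q is again non-negative, compactly supported, bounded, and continuous almost everywhere; consequently, by iteration there exists a sequence (q_i)_{i=1}^∞ in cone(ℱ^d) with ∑_{i=1}^k q_i ≤ p and ∫ ( p − ∑_{i=1}^k q_i ) dλ ≤ 2^{−k} for all k ∈ ℕ, so that ∑_{i=1}^∞ q_i = p in L¹. -/

import Mathlib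

open MeasureTheory Filter Finset

noncomputable section

/-- Membership in `ℱ`: a smooth, Lipschitz continuous pdf on `ℝ`. -/
def IsSmoothLipPdf (f : ℝ → ℝ) : Prop :=
  ContDiff ℝ (⊤ : ℕ∞) f ∧ (∃ L : ℝ, 0 ≤ L ∧ ∀ x y, |f x - f y| ≤ L * |x - y|) ∧
  (∀ x, 0 ≤ f x) ∧ ∫ x, f x = 1

/-- Membership in `cone(ℱ^d)`: a finite non-negative combination of products of smooth
Lipschitz pdfs on `ℝ`. -/
def InConeF (d : ℕ) (q : (Fin d → ℝ) → ℝ) : Prop :=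
  ∃ (m : ℕ) (c : Fin m → ℝ) (s : Fin m → Fin d → ℝ → ℝ),
    (∀ i, 0 ≤ c i) ∧ (∀ i j, IsSmoothLipPdf (s i j)) ∧
    ∀ x, q x = ∑ i, c i * ∏ j, s i j (x j)


/-- The class of functions on which the approximation step is iterated. -/
def GoodFn (d : ℕ) (p : (Fin d → ℝ) → ℝ) : Prop :=
  Measurable p ∧ (∀ x, 0 ≤ p x) ∧ HasCompactSupport p ∧ (∃ M : ℝ, ∀ x, p x ≤ M) ∧
    ∀ᵐ x ∂(volume : Measure (Fin d → ℝ)), ContinuousAt p x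

lemma InConeF.continuous_fn {d : ℕ} {q : (Fin d → ℝ) → ℝ} (hq : InConeF d q) :
    Continuous q := by
  obtain ⟨m, c, s, hc, hs, h⟩ := hq
  have : q = fun x => ∑ i, c i * ∏ j, s i j (x j) := funext h
  rw [this]
  refine continuous_finsetSum _ fun i _ => continuous_const.mul ?_
  exact continuous_finsetProd _ fun j _ => (hs i j).1.continuous.comp (continuous_apply j)

lemma InConeF.nonneg_fn {d : ℕ} {q : (Fin d → ℝ) → ℝ} (hq : InConeF d q) (x) : 0 ≤ q x := by
  obtain ⟨m, c, s, hc, hs, h⟩ := hq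
  rw [h]
  exact Finset.sum_nonneg fun i _ => mul_nonneg (hc i)
    (Finset.prod_nonneg fun j _ => (hs i j).2.2.1 _)

lemma GoodFn.residual {d : ℕ} {p q : (Fin d → ℝ) → ℝ} (hp : GoodFn d p) (hq : InConeF d q)
    (hle : ∀ x, q x ≤ p x) : GoodFn d (fun x => p x - q x) := by
  obtain ⟨hm, hnn, hs, ⟨M, hM⟩, hc⟩ := hp
  refine ⟨hm.sub hq.continuous_fn.measurable, fun x => sub_nonneg.2 (hle x), ?_, ⟨M, fun x => ?_⟩, ?_⟩
  · refine hs.mono fun x hx => ?_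
    simp only [Function.mem_support] at hx ⊢
    intro h0
    have h1 := hle x
    have h2 := hq.nonneg_fn x
    apply hx
    linarith
  · have := hM x
    have h2 := hq.nonneg_fn x
    linarith
  · filter_upwards [hc] with x hx
    exact hx.sub hq.continuous_fn.continuousAt

lemma GoodFn.integrable_fn {d : ℕ} {p : (Fin d → ℝ) → ℝ} (hp : GoodFn d p) :
    Integrable p := by
  obtain ⟨hm, hnn, hs, ⟨M, hM⟩, hc⟩ := hp
  rw [← integrableOn_iff_integrable_of_support_subset (subset_tsupport p)]
  refine Measure.integrableOn_of_bounded (M := M) hs.measure_lt_top.ne hm.aestronglyMeasurable ?_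
  refine Eventually.of_forall fun x => ?_
  rw [Real.norm_eq_abs, abs_of_nonneg (hnn x)]
  exact hM x

/-- The bump whose integer translates form a partition of unity. -/
def bumpPhi (t : ℝ) : ℝ := Real.smoothTransition (t + 1) - Real.smoothTransition t

lemma bumpPhi_nonneg (t : ℝ) : 0 ≤ bumpPhi t := by
  unfold bumpPhi
  rcases le_total t 0 with h | h
  · rw [Real.smoothTransition.zero_of_nonpos h, sub_zero]
    exact Real.smoothTransition.nonneg _
  · rw [Real.smoothTransition.one_of_one_le (by linarith : 1 ≤ t + 1)]
    linarith [Real.smoothTransition.le_one t]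

lemma bumpPhi_ne_zero {t : ℝ} (h : bumpPhi t ≠ 0) : |t| ≤ 1 := by
  by_contra hc
  apply h
  unfold bumpPhi
  rcases lt_abs.1 (not_le.1 hc) with h1 | h1
  · rw [Real.smoothTransition.one_of_one_le (by linarith : 1 ≤ t + 1),
      Real.smoothTransition.one_of_one_le h1.le, sub_self]
  · rw [Real.smoothTransition.zero_of_nonpos (by linarith : t + 1 ≤ 0),
      Real.smoothTransition.zero_of_nonpos (by linarith : t ≤ 0), sub_self]

lemma bumpPhi_zero : bumpPhi 0 = 1 := by
  simp [bumpPhi]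

lemma bumpPhi_contDiff : ContDiff ℝ (⊤ : ℕ∞) bumpPhi := by
  unfold bumpPhi
  exact (Real.smoothTransition.contDiff.comp (contDiff_id.add contDiff_const)).sub
    Real.smoothTransition.contDiff

lemma bumpPhi_sum (u : ℝ) (K : ℕ) : ∑ k : Fin K, bumpPhi (u - (k : ℕ)) =
    Real.smoothTransition (u + 1) - Real.smoothTransition (u + 1 - K) := by
  rw [Fin.sum_univ_eq_sum_range (fun k => bumpPhi (u - (k : ℕ)))]
  have := Finset.sum_range_sub' (fun k : ℕ => Real.smoothTransition (u + 1 - k)) K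
  simp only [Nat.cast_zero, sub_zero] at this
  rw [← this]
  refine Finset.sum_congr rfl fun k _ => ?_
  unfold bumpPhi
  congr 2
  · ring
  · push_cast; ring

/-- The rescaled bumps. -/
def bumpG (n : ℕ) (k : ℕ) (t : ℝ) : ℝ := bumpPhi ((n + 1 : ℝ) * t + (n + 1) ^ 2 - k)

lemma isSmoothLipPdf_normalize {g : ℝ → ℝ} (h1 : ContDiff ℝ (⊤ : ℕ∞) g)
    (h2 : HasCompactSupport g) (h3 : ∀ x, 0 ≤ g x) (h4 : 0 < ∫ x, g x) :
    IsSmoothLipPdf (fun x => (∫ x, g x)⁻¹ * g x) := by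
  refine ⟨contDiff_const.mul h1, ?_, fun x => mul_nonneg (inv_nonneg.2 h4.le) (h3 x), ?_⟩
  · obtain ⟨C, hC⟩ := h1.lipschitzWith_of_hasCompactSupport h2 (by simp)
    refine ⟨(∫ x, g x)⁻¹ * C, by positivity, fun x y => ?_⟩
    rw [← mul_sub, abs_mul, abs_of_nonneg (inv_nonneg.2 h4.le), mul_assoc]
    have := hC.dist_le_mul x y
    rw [Real.dist_eq, Real.dist_eq] at this
    gcongr
  · rw [integral_const_mul, inv_mul_cancel₀ h4.ne']

lemma bumpG_contDiff (n k : ℕ) : ContDiff ℝ (⊤ : ℕ∞) (bumpG n k) := by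
  unfold bumpG
  exact bumpPhi_contDiff.comp (((contDiff_const.mul contDiff_id).add contDiff_const).sub
    contDiff_const)

/-- The centre of the `k`-th rescaled bump. -/
def bumpC (n : ℕ) (k : ℕ) : ℝ := (k - (n + 1) ^ 2) / (n + 1)

lemma bumpG_ne_zero {n k : ℕ} {t : ℝ} (h : bumpG n k t ≠ 0) :
    dist t (bumpC n k) ≤ 1 / (n + 1) := by
  have h1 := bumpPhi_ne_zero h
  have hn : (0 : ℝ) < n + 1 := by positivity
  have : t - bumpC n k = ((n + 1 : ℝ) * t + (n + 1) ^ 2 - k) / (n + 1) := by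
    unfold bumpC; field_simp; ring
  rw [Real.dist_eq, this, abs_div, abs_of_pos hn]
  gcongr

lemma bumpG_compact (n k : ℕ) : HasCompactSupport (bumpG n k) := by
  refine HasCompactSupport.of_support_subset_isCompact
    (isCompact_closedBall (bumpC n k) (1 / (n + 1))) fun t ht => ?_
  exact Metric.mem_closedBall.2 (bumpG_ne_zero ht)

lemma bumpG_integral_pos (n k : ℕ) : 0 < ∫ x, bumpG n k x := by
  refine (bumpG_contDiff n k).continuous.integral_pos_of_hasCompactSupport_nonneg_nonzero
    (bumpG_compact n k) (fun x => bumpPhi_nonneg _) (x := bumpC n k) ?_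
  have hn : (0 : ℝ) < n + 1 := by positivity
  have : (n + 1 : ℝ) * bumpC n k + (n + 1) ^ 2 - k = 0 := by
    unfold bumpC; field_simp; ring
  unfold bumpG
  rw [this, bumpPhi_zero]
  exact one_ne_zero

lemma inConeF_of_bumps {d : ℕ} {ι : Type} [Fintype ι] (c : ι → ℝ) (hc : ∀ i, 0 ≤ c i) (n : ℕ)
    (k : ι → Fin d → ℕ) : InConeF d (fun x => ∑ i, c i * ∏ j, bumpG n (k i j) (x j)) := by
  let e := (Fintype.equivFin ι).symm
  refine ⟨Fintype.card ι, fun i => c (e i) * ∏ j, ∫ t, bumpG n (k (e i) j) t,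
    fun i j t => (∫ t, bumpG n (k (e i) j) t)⁻¹ * bumpG n (k (e i) j) t, ?_, ?_, ?_⟩
  · exact fun i => mul_nonneg (hc _) (Finset.prod_nonneg fun j _ => (bumpG_integral_pos _ _).le)
  · exact fun i j => isSmoothLipPdf_normalize (bumpG_contDiff _ _) (bumpG_compact _ _)
      (fun x => bumpPhi_nonneg _) (bumpG_integral_pos _ _)
  · intro x
    beta_reduce
    rw [← e.sum_comp]
    refine Finset.sum_congr rfl fun i _ => ?_
    rw [mul_assoc, ← Finset.prod_mul_distrib]
    congr 1
    refine Finset.prod_congr rfl fun j _ => ?_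
    rw [mul_inv_cancel_left₀ (bumpG_integral_pos _ _).ne']

/-- The infimum of `p` over the cube carrying the `k`-th product bump. -/
def cubeInf (d : ℕ) (p : (Fin d → ℝ) → ℝ) (n : ℕ) (k : Fin d → ℕ) : ℝ :=
  sInf (p '' Metric.closedBall (fun j => bumpC n (k j)) (1 / (n + 1)))

/-- The lower approximation. -/
def lowerQ (d : ℕ) (p : (Fin d → ℝ) → ℝ) (n : ℕ) (x : Fin d → ℝ) : ℝ :=
  ∑ k : Fin d → Fin (2 * (n + 1) ^ 2),
    cubeInf d p n (fun j => k j) * ∏ j, bumpG n (k j) (x j)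

lemma weights_sum (d n : ℕ) (x : Fin d → ℝ) :
    ∑ k : Fin d → Fin (2 * (n + 1) ^ 2), ∏ j, bumpG n (k j) (x j) =
      ∏ j, (Real.smoothTransition ((n + 1 : ℝ) * x j + (n + 1) ^ 2 + 1) -
        Real.smoothTransition ((n + 1 : ℝ) * x j + (n + 1) ^ 2 + 1 - (2 * (n + 1) ^ 2 : ℕ))) := by
  have : ∀ j, (Real.smoothTransition ((n + 1 : ℝ) * x j + (n + 1) ^ 2 + 1) -
        Real.smoothTransition ((n + 1 : ℝ) * x j + (n + 1) ^ 2 + 1 - (2 * (n + 1) ^ 2 : ℕ))) =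
        ∑ k : Fin (2 * (n + 1) ^ 2), bumpG n k (x j) := fun j => (bumpPhi_sum _ _).symm
  simp_rw [this]
  rw [Finset.prod_univ_sum, Fintype.piFinset_univ]

lemma weights_nonneg {d n : ℕ} (x : Fin d → ℝ) (k : Fin d → ℕ) :
    0 ≤ ∏ j, bumpG n (k j) (x j) := Finset.prod_nonneg fun j _ => bumpPhi_nonneg _

lemma weights_sum_le (d n : ℕ) (x : Fin d → ℝ) :
    ∑ k : Fin d → Fin (2 * (n + 1) ^ 2), ∏ j, bumpG n (k j) (x j) ≤ 1 := by
  rw [weights_sum]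
  refine Finset.prod_le_one (fun j _ => ?_) fun j _ => ?_
  · rw [← bumpPhi_sum]
    exact Finset.sum_nonneg fun k _ => bumpPhi_nonneg _
  · linarith [Real.smoothTransition.le_one ((n + 1 : ℝ) * x j + (n + 1) ^ 2 + 1),
      Real.smoothTransition.nonneg
        ((n + 1 : ℝ) * x j + (n + 1) ^ 2 + 1 - (2 * (n + 1) ^ 2 : ℕ))]

lemma weights_sum_eq (d n : ℕ) (x : Fin d → ℝ) (hx : ‖x‖ ≤ n) :
    ∑ k : Fin d → Fin (2 * (n + 1) ^ 2), ∏ j, bumpG n (k j) (x j) = 1 := by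
  rw [weights_sum]
  refine Finset.prod_eq_one fun j _ => ?_
  have h1 : |x j| ≤ n := (norm_le_pi_norm x j).trans hx
  obtain ⟨h2, h3⟩ := abs_le.1 h1
  have hn : (0 : ℝ) ≤ n := by positivity
  rw [Real.smoothTransition.one_of_one_le, Real.smoothTransition.zero_of_nonpos, sub_zero]
  · push_cast; nlinarith
  · nlinarith

lemma weights_ne_zero {d n : ℕ} {x : Fin d → ℝ} {k : Fin d → ℕ}
    (h : ∏ j, bumpG n (k j) (x j) ≠ 0) :
    x ∈ Metric.closedBall (fun j => bumpC n (k j)) (1 / (n + 1)) := by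
  rw [Finset.prod_ne_zero_iff] at h
  rw [Metric.mem_closedBall, dist_pi_le_iff (by positivity)]
  exact fun j => bumpG_ne_zero (h j (Finset.mem_univ j))

lemma cubeInf_nonneg {d : ℕ} {p : (Fin d → ℝ) → ℝ} (hp : ∀ x, 0 ≤ p x) (n : ℕ)
    (k : Fin d → ℕ) : 0 ≤ cubeInf d p n k := by
  refine Real.sInf_nonneg ?_
  rintro _ ⟨y, -, rfl⟩
  exact hp y

lemma lowerQ_le {d : ℕ} {p : (Fin d → ℝ) → ℝ} (hp : ∀ x, 0 ≤ p x) (n : ℕ) (x) :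
    lowerQ d p n x ≤ p x := by
  calc lowerQ d p n x ≤ ∑ k : Fin d → Fin (2 * (n + 1) ^ 2),
        p x * ∏ j, bumpG n (k j) (x j) := by
        refine Finset.sum_le_sum fun k _ => ?_
        by_cases h : ∏ j, bumpG n (k j) (x j) = 0
        · rw [h]; simp
        · refine mul_le_mul_of_nonneg_right ?_ (weights_nonneg x fun j => k j)
          refine csInf_le ⟨0, ?_⟩ ⟨x, weights_ne_zero (k := fun j => k j) h, rfl⟩
          rintro _ ⟨y, -, rfl⟩
          exact hp y
    _ ≤ p x := by
        rw [← Finset.mul_sum]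
        exact mul_le_of_le_one_right (hp x) (weights_sum_le d n x)

lemma lowerQ_tendsto {d : ℕ} {p : (Fin d → ℝ) → ℝ} (hp : ∀ x, 0 ≤ p x) {x : Fin d → ℝ}
    (hx : ContinuousAt p x) : Tendsto (fun n => lowerQ d p n x) atTop (nhds (p x)) := by
  rw [Metric.tendsto_atTop]
  intro ε hε
  obtain ⟨δ, hδ, h⟩ := Metric.continuousAt_iff.1 hx (ε / 2) (by linarith)
  obtain ⟨N1, hN1⟩ := exists_nat_gt (2 / δ)
  obtain ⟨N2, hN2⟩ := exists_nat_ge ‖x‖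
  refine ⟨max N1 N2, fun n hn => ?_⟩
  have hn1 : (N1 : ℝ) ≤ n := by exact_mod_cast (le_max_left _ _).trans hn
  have hn2 : (N2 : ℝ) ≤ n := by exact_mod_cast (le_max_right _ _).trans hn
  have hlow : p x - ε / 2 ≤ lowerQ d p n x := by
    calc p x - ε / 2 = ∑ k : Fin d → Fin (2 * (n + 1) ^ 2),
          (p x - ε / 2) * ∏ j, bumpG n (k j) (x j) := by
          rw [← Finset.mul_sum, weights_sum_eq d n x (hN2.trans hn2), mul_one]
      _ ≤ lowerQ d p n x := by
        refine Finset.sum_le_sum fun k _ => ?_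
        by_cases hk : ∏ j, bumpG n (k j) (x j) = 0
        · rw [hk]; simp
        · refine mul_le_mul_of_nonneg_right ?_ (weights_nonneg x fun j => k j)
          have hxm := weights_ne_zero (k := fun j => k j) hk
          refine le_csInf ⟨_, x, hxm, rfl⟩ ?_
          rintro _ ⟨y, hy, rfl⟩
          have hd : dist y x < δ := by
            have h3 := dist_triangle_right y x (fun j => bumpC n (k j))
            have h1 := Metric.mem_closedBall.1 hy
            have h2 := Metric.mem_closedBall.1 hxm
            have h4 : 2 / ((n : ℝ) + 1) < δ := by
              rw [div_lt_iff₀ (by positivity)]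
              rw [div_lt_iff₀ hδ] at hN1
              nlinarith
            have h5 : 2 / ((n : ℝ) + 1) = 1 / (n + 1) + 1 / (n + 1) := by ring
            linarith
          have := h hd
          rw [Real.dist_eq] at this
          linarith [(abs_lt.1 this).1]
  have hup := lowerQ_le hp n x
  rw [Real.dist_eq, abs_lt]
  constructor <;> linarith

lemma GoodFn.approx {d : ℕ} {p : (Fin d → ℝ) → ℝ} (hp : GoodFn d p) {δ : ℝ} (hδ : 0 < δ) :
    ∃ q, InConeF d q ∧ (∀ x, q x ≤ p x) ∧ ∫ x, (p x - q x) ≤ δ := by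
  have hcone : ∀ n, InConeF d (lowerQ d p n) := fun n =>
    inConeF_of_bumps (fun k : Fin d → Fin (2 * (n + 1) ^ 2) => cubeInf d p n (fun j => k j))
      (fun k => cubeInf_nonneg hp.2.1 _ _) n (fun k j => k j)
  have hle : ∀ n x, lowerQ d p n x ≤ p x := fun n x => lowerQ_le hp.2.1 n x
  have ht : Tendsto (fun n => ∫ x, (p x - lowerQ d p n x)) atTop
      (nhds (∫ _ : Fin d → ℝ, (0 : ℝ))) := by
    refine tendsto_integral_of_dominated_convergence p
      (fun n => (hp.residual (hcone n) (hle n)).1.aestronglyMeasurable) hp.integrable_fn ?_ ?_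
    · refine fun n => Eventually.of_forall fun x => ?_
      rw [Real.norm_eq_abs, abs_of_nonneg (sub_nonneg.2 (hle n x))]
      linarith [(hcone n).nonneg_fn x]
    · filter_upwards [hp.2.2.2.2] with x hx
      simpa using (lowerQ_tendsto hp.2.1 hx).const_sub (p x)
  rw [integral_zero] at ht
  obtain ⟨n, hn⟩ := (ht.eventually (gt_mem_nhds hδ)).exists
  exact ⟨_, hcone n, hle n, hn.le⟩

lemma GoodFn.iterate {d : ℕ} {p : (Fin d → ℝ) → ℝ} (hp : GoodFn d p) :
    ∃ qs : ℕ → (Fin d → ℝ) → ℝ,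
      (∀ i, InConeF d (qs i)) ∧
      (∀ k : ℕ, (∀ x, ∑ i ∈ range (k + 1), qs i x ≤ p x) ∧
        ∫ x, (p x - ∑ i ∈ range (k + 1), qs i x) ≤ (1 / 2 : ℝ) ^ (k + 1)) ∧
      Tendsto (fun k => ∫ x, |p x - ∑ i ∈ range k, qs i x|) atTop (nhds 0) := by
  have key : ∀ (k : ℕ) (r : {r // GoodFn d r}), ∃ q, InConeF d q ∧ (∀ x, q x ≤ r.1 x) ∧
      ∫ x, (r.1 x - q x) ≤ (1 / 2 : ℝ) ^ (k + 1) := fun k r => r.2.approx (by positivity)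
  choose Q hQ1 hQ2 hQ3 using key
  let r : ℕ → {r // GoodFn d r} := fun k => Nat.rec ⟨p, hp⟩
    (fun k r => ⟨fun x => r.1 x - Q k r x, r.2.residual (hQ1 k r) (hQ2 k r)⟩) k
  have hr : ∀ k x, p x - ∑ i ∈ range k, Q i (r i) x = (r k).1 x := by
    intro k x
    induction k with
    | zero => simp [r]
    | succ k ih =>
      rw [Finset.sum_range_succ, ← sub_sub, ih]
  have hint : ∀ k, ∫ x, (p x - ∑ i ∈ range (k + 1), Q i (r i) x) ≤ (1 / 2 : ℝ) ^ (k + 1) := by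
    intro k
    simp_rw [hr]
    exact hQ3 k (r k)
  refine ⟨fun k => Q k (r k), fun i => hQ1 _ _, fun k => ⟨fun x => ?_, hint k⟩, ?_⟩
  · have h1 := hr (k + 1) x
    have h2 := (r (k + 1)).2.2.1 x
    linarith
  · rw [← tendsto_add_atTop_iff_nat 1]
    refine squeeze_zero (g := fun k => (1 / 2 : ℝ) ^ (k + 1))
      (fun k => integral_nonneg fun x => abs_nonneg _) (fun k => ?_) ?_
    · refine le_trans (le_of_eq ?_) (hint k)
      refine integral_congr_ae (Eventually.of_forall fun x => ?_)
      refine abs_of_nonneg ?_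
      rw [hr]
      exact (r (k + 1)).2.2.1 x
    · exact (tendsto_add_atTop_iff_nat 1).2
        (tendsto_pow_atTop_nhds_zero_of_lt_one (by norm_num) (by norm_num))

/-- **Iteration step of Lemma 8.** If `q ∈ cone(ℱ^d)` fits under `p` with
`∫ (p − q) ≤ ε`, then `p − q` is again non-negative, compactly supported, bounded and
a.e. continuous; consequently, by iteration, there is a sequence `(q_i)` in `cone(ℱ^d)`
with `∑_{i=1}^k q_i ≤ p` and `∫ (p − ∑_{i=1}^k q_i) ≤ 2^{−k}` for all `k ≥ 1` (here the
paper's `k` is `k+1` with `k : ℕ`), so that `∑_{i=1}^∞ q_i = p` in `L¹`. -/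
theorem cone_residual_and_iteration
    (d : ℕ) (hd : 1 ≤ d) (p : (Fin d → ℝ) → ℝ)
    (hmeas : Measurable p) (hnn : ∀ x, 0 ≤ p x)
    (hsupp : HasCompactSupport p) (hbdd : ∃ M : ℝ, ∀ x, p x ≤ M)
    (hcont : ∀ᵐ x ∂(volume : Measure (Fin d → ℝ)), ContinuousAt p x)
    (ε : ℝ) (hε : 0 < ε)
    (q : (Fin d → ℝ) → ℝ) (hq : InConeF d q)
    (hqle : ∀ x, q x ≤ p x) (hqint : ∫ x, (p x - q x) ≤ ε) :
    ((∀ x, 0 ≤ p x - q x) ∧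
      HasCompactSupport (fun x => p x - q x) ∧
      (∃ M : ℝ, ∀ x, p x - q x ≤ M) ∧
      (∀ᵐ x ∂(volume : Measure (Fin d → ℝ)),
        ContinuousAt (fun y => p y - q y) x)) ∧
    (∃ qs : ℕ → (Fin d → ℝ) → ℝ,
      (∀ i, InConeF d (qs i)) ∧
      (∀ k : ℕ, (∀ x, ∑ i ∈ range (k + 1), qs i x ≤ p x) ∧
        ∫ x, (p x - ∑ i ∈ range (k + 1), qs i x) ≤ (1 / 2 : ℝ) ^ (k + 1)) ∧
      Tendsto (fun k => ∫ x, |p x - ∑ i ∈ range k, qs i x|) atTop (nhds 0)) := by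
  have hp : GoodFn d p := ⟨hmeas, hnn, hsupp, hbdd, hcont⟩
  exact ⟨(hp.residual hq hqle).2, hp.iterate⟩
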